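/- arXiv:2508.18306 — 6 statements merged into one kernel-verified Lean document; each statement's English description precedes it below -/
import Mathlib

section
/- Let n ≥ 1 and let L_X and L_Y be real symmetric positive definite n×n matrices, and let λ_max := sSup (spectrum ℝ (L_X⁻¹ * L_Y)) be the largest real eigenvalue of L_X⁻¹·L_Y. Then for every pair of distinct indices p ≠ q, the distance mapping distortion ratio satisfies ((e_p − e_q)ᵀ L_Y⁻¹ (e_p − e_q)) / ((e_p − e_q)ᵀ L_X⁻¹ (e_p − e_q)) ≥ 1 / λ_max. In particular, the minimum distance mapping distortion γ^F_min over all node pairs is at least 1/λ_max(L_X⁻¹ L_Y). -/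
open Matrix

/-- If every real eigenvalue of `A⁻¹ * B` is at most `c`, then `A⁻¹ ≤ c • B⁻¹` in the Loewner
order. -/
theorem Matrix.PosDef.posSemidef_smul_inv_sub_inv {m : Type*} [Fintype m] [DecidableEq m]
    {A B : Matrix m m ℝ} (hA : A.PosDef) (hB : B.PosDef) {c : ℝ}
    (hc : ∀ x ∈ spectrum ℝ (A⁻¹ * B), x ≤ c) : (c • B⁻¹ - A⁻¹).PosSemidef := by
  obtain ⟨D, rfl⟩ : ∃ D : Matrix m m ℝ, B = Dᴴ * D := by
    open scoped MatrixOrder in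
    exact CStarAlgebra.nonneg_iff_eq_star_mul_self.mp hB.posSemidef.nonneg
  have hD : IsUnit D := by
    have h := (isUnit_iff_isUnit_det _).mp hB.isUnit
    rw [det_mul] at h
    exact (isUnit_iff_isUnit_det D).mpr (isUnit_of_mul_isUnit_right h)
  have hDD : D⁻¹ * D = 1 := nonsing_inv_mul D ((isUnit_iff_isUnit_det D).mp hD)
  have hDs : Dᴴ * (D⁻¹)ᴴ = 1 := by
    rw [← conjTranspose_mul, hDD, conjTranspose_one]
  have hspec : spectrum ℝ (D * A⁻¹ * Dᴴ) = spectrum ℝ (A⁻¹ * (Dᴴ * D)) := by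
    obtain ⟨u, rfl⟩ := hD
    rw [← spectrum.units_conjugate (a := A⁻¹ * _) (u := u)]
    simp [mul_assoc]
  have hpos : (algebraMap ℝ (Matrix m m ℝ) c - D * A⁻¹ * Dᴴ).PosSemidef := by
    refine posSemidef_iff_isHermitian_and_spectrum_nonneg.mpr ⟨?_, ?_⟩
    · rw [Algebra.algebraMap_eq_smul_one]
      exact (isHermitian_one.smul (IsSelfAdjoint.all c)).sub
        (isHermitian_mul_mul_conjTranspose D hA.1.inv)
    · rw [← spectrum.singleton_sub_eq, hspec]
      rintro _ ⟨_, rfl, x, hx, rfl⟩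
      exact sub_nonneg.mpr (hc x hx)
  convert hpos.mul_mul_conjTranspose_same D⁻¹ using 1
  have hmid : D⁻¹ * (D * A⁻¹ * Dᴴ) * (D⁻¹)ᴴ = A⁻¹ := by
    calc D⁻¹ * (D * A⁻¹ * Dᴴ) * (D⁻¹)ᴴ = (D⁻¹ * D) * A⁻¹ * (Dᴴ * (D⁻¹)ᴴ) := by
          simp only [mul_assoc]
      _ = A⁻¹ := by rw [hDD, hDs, one_mul, mul_one]
  rw [mul_sub, sub_mul, hmid, Matrix.mul_inv_rev, Algebra.algebraMap_eq_smul_one,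
    conjTranspose_nonsing_inv]
  simp

/-- Theorem 3 of the paper (positive definite formulation): the distance mapping
distortion ratio of every node pair is at least `1 / λ_max(L_X⁻¹ L_Y)`. -/
theorem gammaFmin_bound {n : ℕ} (hn : 1 ≤ n)
    (LX LY : Matrix (Fin n) (Fin n) ℝ) (hLX : LX.PosDef) (hLY : LY.PosDef)
    (p q : Fin n) (hpq : p ≠ q) :
    ((Pi.single p 1 - Pi.single q 1 : Fin n → ℝ) ⬝ᵥ
        (LY⁻¹).mulVec (Pi.single p 1 - Pi.single q 1)) /
      ((Pi.single p 1 - Pi.single q 1 : Fin n → ℝ) ⬝ᵥ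
        (LX⁻¹).mulVec (Pi.single p 1 - Pi.single q 1)) ≥
      1 / sSup (spectrum ℝ (LX⁻¹ * LY)) := by
  set v : Fin n → ℝ := Pi.single p 1 - Pi.single q 1
  have hv : v ≠ 0 := by
    intro h
    have := congrFun h p
    simp [v, hpq] at this
  have hX : 0 < v ⬝ᵥ LX⁻¹ *ᵥ v := by simpa using hLX.inv.dotProduct_mulVec_pos hv
  have hY : 0 < v ⬝ᵥ LY⁻¹ *ᵥ v := by simpa using hLY.inv.dotProduct_mulVec_pos hv
  have key : v ⬝ᵥ LX⁻¹ *ᵥ v ≤ sSup (spectrum ℝ (LX⁻¹ * LY)) * (v ⬝ᵥ LY⁻¹ *ᵥ v) := by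
    have h := (hLX.posSemidef_smul_inv_sub_inv hLY fun x hx ↦
      le_csSup finite_real_spectrum.bddAbove hx).dotProduct_mulVec_nonneg v
    simpa [sub_mulVec, smul_mulVec, dotProduct_sub] using h
  have hpos : 0 < sSup (spectrum ℝ (LX⁻¹ * LY)) := pos_of_mul_pos_left (hX.trans_le key) hY.le
  rw [ge_iff_le, div_le_div_iff₀ hpos hX]
  linarith
end

section
/- Let n ≥ 1 and let L_X and L_Y be real symmetric positive definite n×n matrices. Then for every pair of distinct indices p ≠ q, the distance mapping distortion ratio satisfies ((e_p − e_q)ᵀ L_Y⁻¹ (e_p − e_q)) / ((e_p − e_q)ᵀ L_X⁻¹ (e_p − e_q)) ≤ sSup (spectrum ℝ (L_Y⁻¹ * L_X)). In particular, the maximum distance mapping distortion γ^F_max over all node pairs is at most λ_max(L_Y⁻¹ L_X). -/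
open Matrix

open scoped MatrixOrder in
/-- The Rayleigh quotient of a real symmetric matrix is bounded by its largest eigenvalue. -/
theorem Matrix.IsHermitian.dotProduct_mulVec_le_sSup_spectrum {n : Type*} [Fintype n]
    [DecidableEq n] {B : Matrix n n ℝ} (hB : B.IsHermitian) (w : n → ℝ) :
    w ⬝ᵥ B *ᵥ w ≤ sSup (spectrum ℝ B) * (w ⬝ᵥ w) := by
  have hle : B ≤ algebraMap ℝ (Matrix n n ℝ) (sSup (spectrum ℝ B)) :=
    le_algebraMap_of_spectrum_le
      (fun x hx => le_csSup B.finite_spectrum.bddAbove hx) hB.isSelfAdjoint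
  have h := (Matrix.le_iff.mp hle).dotProduct_mulVec_nonneg w
  simpa [Algebra.algebraMap_eq_smul_one, sub_mulVec, smul_mulVec, dotProduct_sub] using h

open scoped MatrixOrder ComplexOrder in
/-- The generalized Rayleigh quotient of `N⁻¹` against `M⁻¹` is bounded by the largest eigenvalue
of `N⁻¹ * M`. -/
theorem Matrix.PosDef.dotProduct_inv_mulVec_le {n : Type*} [Fintype n] [DecidableEq n]
    {M N : Matrix n n ℝ} (hM : M.PosDef) (hN : N.IsHermitian) (x : n → ℝ) :
    x ⬝ᵥ N⁻¹ *ᵥ x ≤ sSup (spectrum ℝ (N⁻¹ * M)) * (x ⬝ᵥ M⁻¹ *ᵥ x) := by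
  obtain ⟨S, hS, rfl⟩ :=
    CStarAlgebra.isStrictlyPositive_iff_eq_star_mul_self.mp hM.isStrictlyPositive
  have hdet : IsUnit S.det := (isUnit_iff_isUnit_det S).mp hS
  have hdetT : IsUnit Sᵀ.det := by rwa [det_transpose]
  have hstar : star S = Sᵀ := by rw [star_eq_conjTranspose, conjTranspose_eq_transpose_of_trivial]
  obtain ⟨w, rfl⟩ : ∃ w, Sᵀ *ᵥ w = x :=
    ⟨Sᵀ⁻¹ *ᵥ x, by rw [mulVec_mulVec, mul_nonsing_inv _ hdetT, one_mulVec]⟩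
  have hspec : spectrum ℝ (N⁻¹ * (star S * S)) = spectrum ℝ (S * N⁻¹ * Sᵀ) := by
    obtain ⟨u, rfl⟩ := hS
    rw [← spectrum.units_conjugate (R := ℝ) (u := u)]
    congr 1
    simp [mul_assoc, hstar]
  have hB : (S * N⁻¹ * Sᵀ).IsHermitian := by
    simpa using isHermitian_mul_mul_conjTranspose S hN.inv
  have h := hB.dotProduct_mulVec_le_sSup_spectrum w
  have hcongr (A : Matrix n n ℝ) : (Sᵀ *ᵥ w) ⬝ᵥ A *ᵥ (Sᵀ *ᵥ w) = w ⬝ᵥ (S * A * Sᵀ) *ᵥ w := by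
    rw [← mulVec_mulVec, ← mulVec_mulVec, dotProduct_mulVec w S, mulVec_transpose]
  have hone : S * (Sᵀ * S)⁻¹ * Sᵀ = 1 := by
    rw [mul_inv_rev, ← mul_assoc, mul_nonsing_inv _ hdet, one_mul, nonsing_inv_mul _ hdetT]
  rwa [hspec, hstar, hcongr, hcongr, hone, one_mulVec]

/-- The spectral upper bound on the distance mapping distortion:
`γ^F(p,q) ≤ λ_max(L_Y⁻¹ L_X)` for every pair of distinct nodes. -/
theorem gammaFmax_bound {n : ℕ} (hn : 1 ≤ n)
    (LX LY : Matrix (Fin n) (Fin n) ℝ) (hLX : LX.PosDef) (hLY : LY.PosDef)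
    (p q : Fin n) (hpq : p ≠ q) :
    ((Pi.single p 1 - Pi.single q 1 : Fin n → ℝ) ⬝ᵥ
        (LY⁻¹).mulVec (Pi.single p 1 - Pi.single q 1)) /
      ((Pi.single p 1 - Pi.single q 1 : Fin n → ℝ) ⬝ᵥ
        (LX⁻¹).mulVec (Pi.single p 1 - Pi.single q 1)) ≤
      sSup (spectrum ℝ (LY⁻¹ * LX)) := by
  have hne : (Pi.single p 1 - Pi.single q 1 : Fin n → ℝ) ≠ 0 := fun h => by
    simpa [hpq] using congrFun h p
  have hpos := hLX.inv.dotProduct_mulVec_pos hne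
  rw [star_trivial] at hpos
  exact (div_le_iff₀ hpos).mpr (hLX.dotProduct_inv_mulVec_le hLY.isHermitian _)
end

section
/- Let n, d ≥ 1, let p ≠ q be indices in Fin n, set u := e_p − e_q, let L₀ be a real symmetric positive semidefinite n×n matrix, let σ ≠ 0 and k > 0 be reals, and let X be a real n×d matrix. For w ∈ ℝ define Θ(w) = L₀ + w · u uᵀ + (1/σ²)·I and F(w) = log det Θ(w) − (1/k)·Tr(Xᵀ Θ(w) X). Then for every w ≥ 0 the matrix Θ(w) is positive definite and F is differentiable at w with F′(w) = uᵀ Θ(w)⁻¹ u − (1/k)·‖X_p − X_q‖₂². -/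
open Matrix

namespace Matrix

variable {m n : Type*} [Fintype m]

/-- The matrix determinant lemma for a scaled rank-one update. -/
theorem det_add_smul_vecMulVec [DecidableEq m] {R : Type*} [CommRing R] {A : Matrix m m R}
    (hA : IsUnit A.det) (t : R) (u v : m → R) :
    (A + t • vecMulVec u v).det = A.det * (1 + t * (v ⬝ᵥ A⁻¹ *ᵥ u)) := by
  have h := det_add_replicateCol_mul_replicateRow (ι := Unit) hA (t • u) v
  rw [← vecMulVec_eq, smul_vecMulVec] at h
  rw [h, det_unique (n := Unit), add_apply, one_apply_eq, Matrix.mul_assoc, ← replicateCol_mulVec,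
    replicateRow_mul_replicateCol_apply, mulVec_smul, dotProduct_smul, smul_eq_mul]

/-- The derivative of the log-determinant along a rank-one perturbation. -/
theorem hasDerivAt_log_det_add_smul_vecMulVec [DecidableEq m]
    {A : Matrix m m ℝ} {u v : m → ℝ} {w : ℝ}
    (h : (A + w • vecMulVec u v).det ≠ 0) :
    HasDerivAt (fun t : ℝ => Real.log (A + t • vecMulVec u v).det)
      (v ⬝ᵥ (A + w • vecMulVec u v)⁻¹ *ᵥ u) w := by
  set B := A + w • vecMulVec u v with hB
  set c := v ⬝ᵥ B⁻¹ *ᵥ u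
  have hdet : (fun t : ℝ => (A + t • vecMulVec u v).det) =
      fun t => B.det * (1 + (t - w) * c) := by
    funext t
    rw [← det_add_smul_vecMulVec h.isUnit, hB, add_assoc, ← add_smul, add_sub_cancel]
  have hd : HasDerivAt (fun t : ℝ => (A + t • vecMulVec u v).det) (B.det * c) w := by
    rw [hdet]
    simpa using ((((hasDerivAt_id w).sub_const w).mul_const c).const_add 1).const_mul B.det
  simpa [← hB, h] using hd.log h

theorem trace_transpose_mul_vecMulVec_mul [Fintype n] {R : Type*} [CommRing R] (X : Matrix m n R)
    (u v : m → R) :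
    (Xᵀ * vecMulVec u v * X).trace = (u ᵥ* X) ⬝ᵥ (v ᵥ* X) := by
  rw [mul_vecMulVec, vecMulVec_mul, trace_vecMulVec, mulVec_transpose]

end Matrix

/-- The gradient of the PGM objective with respect to a single edge weight:
`F′(w) = uᵀ Θ(w)⁻¹ u − (1/k)·‖X_p − X_q‖₂²`, where `Θ(w) = L₀ + w·u uᵀ + (1/σ²) I`
is positive definite for every `w ≥ 0`. -/
theorem pgm_objective_gradient {n d : ℕ} (hn : 1 ≤ n) (hd : 1 ≤ d)
    (p q : Fin n) (hpq : p ≠ q)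
    (L0 : Matrix (Fin n) (Fin n) ℝ) (hL0 : L0.PosSemidef)
    (σ k : ℝ) (hσ : σ ≠ 0) (hk : 0 < k) (X : Matrix (Fin n) (Fin d) ℝ) :
    let u : Fin n → ℝ := Pi.single p 1 - Pi.single q 1
    let Θ : ℝ → Matrix (Fin n) (Fin n) ℝ := fun w =>
      L0 + w • vecMulVec u u + (1 / σ ^ 2) • (1 : Matrix (Fin n) (Fin n) ℝ)
    let F : ℝ → ℝ := fun w =>
      Real.log (Θ w).det - (1 / k) * Matrix.trace (Xᵀ * Θ w * X)
    ∀ w : ℝ, 0 ≤ w →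
      (Θ w).PosDef ∧
        HasDerivAt F
          (u ⬝ᵥ (Θ w)⁻¹.mulVec u - (1 / k) * ∑ j, (X p j - X q j) ^ 2) w := by
  intro u Θ F w hw
  have hpos : (Θ w).PosDef := by
    have huu : (vecMulVec u u).PosSemidef := by simpa using posSemidef_vecMulVec_self_star u
    exact PosDef.posSemidef_add (hL0.add (huu.smul hw)) (PosDef.one.smul (by positivity))
  refine ⟨hpos, ?_⟩
  set C := L0 + (1 / σ ^ 2) • (1 : Matrix (Fin n) (Fin n) ℝ) with hC
  have hΘ (t : ℝ) : Θ t = C + t • vecMulVec u u := add_right_comm _ _ _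
  have hlog : HasDerivAt (fun t => Real.log (Θ t).det) (u ⬝ᵥ (Θ w)⁻¹ *ᵥ u) w := by
    simp only [hΘ]
    exact hasDerivAt_log_det_add_smul_vecMulVec (hΘ w ▸ hpos.det_pos.ne')
  have htrace : HasDerivAt (fun t => (Xᵀ * Θ t * X).trace) (∑ j, (X p j - X q j) ^ 2) w := by
    have hu : (Xᵀ * vecMulVec u u * X).trace = ∑ j, (X p j - X q j) ^ 2 := by
      rw [trace_transpose_mul_vecMulVec_mul]
      simp [u, sub_vecMul, dotProduct, sq]
    simp only [hΘ, Matrix.mul_add, Matrix.add_mul, Matrix.mul_smul, Matrix.smul_mul,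
      trace_add, trace_smul, hu, smul_eq_mul]
    simpa using ((hasDerivAt_id w).mul_const (∑ j, (X p j - X q j) ^ 2)).const_add
      (Xᵀ * C * X).trace
  exact hlog.sub (htrace.const_mul (1 / k))
end

section
/- In the setting of the gradient computation for the PGM objective — n, d ≥ 1, indices p ≠ q in Fin n, u := e_p − e_q, a real symmetric positive semidefinite n×n matrix L₀, reals σ ≠ 0 and k > 0, a real n×d matrix X with X_p ≠ X_q, Θ(w) = L₀ + w·u uᵀ + (1/σ²)·I and F(w) = log det Θ(w) − (1/k)·Tr(Xᵀ Θ(w) X) — suppose the weight is the reciprocal of the squared data distance, w = ‖X_p − X_q‖₂^{-2} , and the distance ratio ρ_{p,q} := w · (uᵀ Θ(w)⁻¹ u) satisfies ρ_{p,q} < 1/k. Then the derivative of F at w is strictly negative, i.e. decreasing the weight of such a low-ratio edge strictly increases the objective F. -/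
open Matrix

/-- The matrix determinant lemma for a scaled symmetric rank-one update. -/
lemma Matrix.det_add_smul_vecMulVec_self {m R : Type*} [Fintype m] [DecidableEq m] [CommRing R]
    {A : Matrix m m R} (hA : IsUnit A.det) (t : R) (u : m → R) :
    (A + t • vecMulVec u u).det = A.det * (1 + t * (u ⬝ᵥ A⁻¹.mulVec u)) := by
  have h := det_add_replicateCol_mul_replicateRow (ι := Unit) hA (t • u) u
  rw [← vecMulVec_eq, smul_vecMulVec] at h
  rw [h, ← replicateRow_vecMul, det_unique (n := Unit), add_apply, one_apply_eq,
    replicateRow_mul_replicateCol_apply, dotProduct_smul, dotProduct_mulVec, smul_eq_mul]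

/-- The trace of a congruence transform of `u uᵀ` is the squared length of `Xᵀ u`. -/
lemma Matrix.trace_transpose_mul_vecMulVec_self_mul {m l R : Type*} [Fintype m] [Fintype l]
    [CommRing R] (X : Matrix m l R) (u : m → R) :
    trace (Xᵀ * vecMulVec u u * X) = ∑ j, (u ᵥ* X) j ^ 2 := by
  rw [mul_vecMulVec, vecMulVec_mul, trace_vecMulVec, mulVec_transpose]
  simp [dotProduct, sq]

/-- The pruning criterion of Theorem 1: if the weight of edge `(p,q)` equals the
reciprocal of its squared data distance and its distance ratio
`ρ_{p,q} = w · (uᵀ Θ(w)⁻¹ u)` is below `1/k`, then the PGM objective `F` has a strictly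
negative derivative at `w`, i.e. decreasing the weight of such a low-ratio edge strictly
increases `F`. -/
theorem pruning_low_ratio_edge {n d : ℕ} (hn : 1 ≤ n) (hd : 1 ≤ d)
    (p q : Fin n) (hpq : p ≠ q)
    (L0 : Matrix (Fin n) (Fin n) ℝ) (hL0 : L0.PosSemidef)
    (σ k : ℝ) (hσ : σ ≠ 0) (hk : 0 < k) (X : Matrix (Fin n) (Fin d) ℝ)
    (hX : X p ≠ X q) :
    let u : Fin n → ℝ := Pi.single p 1 - Pi.single q 1
    let Θ : ℝ → Matrix (Fin n) (Fin n) ℝ := fun w =>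
      L0 + w • vecMulVec u u + (1 / σ ^ 2) • (1 : Matrix (Fin n) (Fin n) ℝ)
    let F : ℝ → ℝ := fun w =>
      Real.log (Θ w).det - (1 / k) * Matrix.trace (Xᵀ * Θ w * X)
    let w : ℝ := (∑ j, (X p j - X q j) ^ 2)⁻¹
    w * (u ⬝ᵥ (Θ w)⁻¹.mulVec u) < 1 / k → deriv F w < 0 := by
  intro u Θ F w hρ
  set S : ℝ := ∑ j, (X p j - X q j) ^ 2 with hS
  set r : ℝ := u ⬝ᵥ (Θ w)⁻¹.mulVec u
  have hS_pos : 0 < S := by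
    obtain ⟨j, hj⟩ := Function.ne_iff.mp hX
    exact Finset.sum_pos' (fun _ _ => sq_nonneg _)
      ⟨j, Finset.mem_univ j, sq_pos_of_ne_zero (sub_ne_zero.mpr hj)⟩
  have hΘ_pos : (Θ w).PosDef := by
    have hu : (vecMulVec u u).PosSemidef := by
      simpa using posSemidef_vecMulVec_self_star u
    exact PosDef.posSemidef_add (hL0.add (hu.smul (inv_nonneg.mpr hS_pos.le)))
      (PosDef.one.smul (by positivity))
  have hdet := hΘ_pos.det_pos
  have hΘ_add (x : ℝ) : Θ x = Θ w + (x - w) • vecMulVec u u := by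
    simp only [Θ, sub_smul]
    abel
  have hF : F = fun x => Real.log ((Θ w).det * (1 + (x - w) * r)) -
      (1 / k) * (trace (Xᵀ * Θ w * X) + (x - w) * S) := by
    funext x
    have htrace : trace (Xᵀ * vecMulVec u u * X) = S := by
      rw [trace_transpose_mul_vecMulVec_self_mul]
      simp [u, sub_vecMul, hS, row]
    simp only [F]
    rw [hΘ_add x, det_add_smul_vecMulVec_self hdet.ne'.isUnit, Matrix.mul_add, Matrix.add_mul,
      trace_add, Matrix.mul_smul, Matrix.smul_mul, trace_smul, htrace, smul_eq_mul]
  have hsub := (hasDerivAt_id w).sub_const w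
  have hderiv : HasDerivAt F (r - (1 / k) * S) w := by
    rw [hF]
    have hlog := (((hsub.mul_const r).const_add 1).const_mul (Θ w).det).log
      (by simpa using hdet.ne')
    have htr := ((hsub.mul_const S).const_add (trace (Xᵀ * Θ w * X))).const_mul (1 / k)
    exact (hlog.sub htr).congr_deriv (by simp [hdet.ne'])
  rw [hderiv.deriv, sub_neg]
  have h := mul_lt_mul_of_pos_right hρ hS_pos
  rwa [mul_right_comm, inv_mul_cancel₀ hS_pos.ne', one_mul] at h
end

section
/- Let N ≥ 1 and 1 ≤ r ≤ N. Let P and Q be real N×N matrices, u_1, …, u_N ∈ ℝ^N, λ_1, …, λ_N ≥ 0 and β_1, …, β_N ∈ ℝ, with u_iᵀ P u_j = 1 if i = j and 0 otherwise, and u_iᵀ Q u_j = λ_i if i = j and 0 otherwise. Define v_i = β_i · (Q u_i) and let V_r be the N×r matrix with i-th column √λ_i · v_i. Suppose e = α · u_k for some α ≠ 0 and some k with 1 ≤ k ≤ r. Then the distortion γ := (eᵀ Q e)/(eᵀ P e) equals λ_k, and ‖V_rᵀ e‖₂² = α² β_k² λ_k³ = α² β_k² γ³. -/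
open Matrix

/-- The aligned-edge case of Theorem 4: if `e = α u_k` is aligned with a single
generalized eigenvector `u_k` (`k ≤ r`), then the distortion
`γ = (eᵀ Q e)/(eᵀ P e)` equals `λ_k` and the spectral embedding norm satisfies
`‖V_rᵀ e‖₂² = α² β_k² λ_k³ = α² β_k² γ³`. -/
theorem aligned_edge_cubic_law {N r : ℕ} (hN : 1 ≤ N) (hr : 1 ≤ r) (hrN : r ≤ N)
    (P Q : Matrix (Fin N) (Fin N) ℝ) (u : Fin N → Fin N → ℝ)
    (lam β : Fin N → ℝ) (hlam : ∀ i, 0 ≤ lam i)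
    (hP : ∀ i j, u i ⬝ᵥ P.mulVec (u j) = if i = j then 1 else 0)
    (hQ : ∀ i j, u i ⬝ᵥ Q.mulVec (u j) = if i = j then lam i else 0)
    (k : Fin N) (hk : (k : ℕ) < r) (α : ℝ) (hα : α ≠ 0) :
    let v : Fin N → Fin N → ℝ := fun i => β i • Q.mulVec (u i)
    let V : Matrix (Fin N) (Fin r) ℝ := fun a i =>
      Real.sqrt (lam (Fin.castLE hrN i)) * v (Fin.castLE hrN i) a
    let e : Fin N → ℝ := α • u k
    let γ : ℝ := (e ⬝ᵥ Q.mulVec e) / (e ⬝ᵥ P.mulVec e)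
    γ = lam k ∧
      (∑ i, (Vᵀ.mulVec e i) ^ 2 = α ^ 2 * (β k) ^ 2 * (lam k) ^ 3 ∧
        α ^ 2 * (β k) ^ 2 * (lam k) ^ 3 = α ^ 2 * (β k) ^ 2 * γ ^ 3) := by
  intro v V e γ
  have hγ : γ = lam k := by
    simp only [γ, e, Matrix.mulVec_smul, smul_dotProduct, dotProduct_smul, hP, hQ, if_true,
      smul_eq_mul]
    field_simp
  have hV : ∀ i : Fin r, (Vᵀ.mulVec e) i =
      if i = ⟨k, hk⟩ then α * β k * (Real.sqrt (lam k) * lam k) else 0 := by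
    intro i
    have hcol : (Vᵀ.mulVec e) i = α * β (Fin.castLE hrN i) * Real.sqrt (lam (Fin.castLE hrN i)) *
        (u k ⬝ᵥ Q.mulVec (u (Fin.castLE hrN i))) := by
      rw [dotProduct, Finset.mul_sum]
      change ∑ a, V a i * e a = _
      refine Finset.sum_congr rfl fun a _ => ?_
      change Real.sqrt (lam (Fin.castLE hrN i)) *
        (β (Fin.castLE hrN i) * Q.mulVec (u (Fin.castLE hrN i)) a) * (α * u k a) = _
      ring
    rw [hcol, hQ]
    by_cases h : i = ⟨k, hk⟩
    · subst h
      simp [mul_assoc]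
    · have hne : k ≠ Fin.castLE hrN i := fun hki => h (Fin.ext (congrArg Fin.val hki).symm)
      simp [h, hne]
  refine ⟨hγ, ?_, by rw [hγ]⟩
  simp only [hV, ite_pow, ne_eq, OfNat.ofNat_ne_zero, not_false_eq_true, zero_pow,
    Finset.sum_ite_eq', Finset.mem_univ, if_true]
  rw [mul_pow, mul_pow, mul_pow, Real.sq_sqrt (hlam k)]
  ring
end

section
/- Let N ≥ 1 and 1 ≤ r ≤ N. Let P and Q be real N×N matrices. Suppose u_1, …, u_N ∈ ℝ^N, λ_1, …, λ_N ≥ 0, β_1, …, β_N ∈ ℝ satisfy u_iᵀ P u_j = δ_{ij} and u_iᵀ Q u_j = λ_i δ_{ij}, with v_i = β_i·(Q u_i) and V_r the N×r matrix with columns √λ_i · v_i (i ≤ r). Suppose dually that u′_1, …, u′_N ∈ ℝ^N, μ_1, …, μ_N ≥ 0, β′_1, …, β′_N ∈ ℝ satisfy u′_iᵀ Q u′_j = δ_{ij} and u′_iᵀ P u′_j = μ_i δ_{ij}, with w_i = β′_i·(P u′_i) and W_r the N×r matrix with columns √μ_i · w_i (i ≤ r). If e = α·u_k = α′·u′_k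 for some k ≤ r with α, α′ ≠ 0, λ_k > 0 and μ_k = λ_k⁻¹, then, writing γ := (eᵀ Q e)/(eᵀ P e) = λ_k, one has ‖V_rᵀ e‖₂² + ‖W_rᵀ e‖₂² = α² β_k² γ³ + α′² β′_k² γ⁻³. -/
open Matrix

/-- The spectral-embedding energy of a multiple of the `k`-th member of a family that diagonalizes
the bilinear form of `M`. -/
theorem sum_sq_embedding_mulVec_smul {N r : ℕ} (hrN : r ≤ N) (M : Matrix (Fin N) (Fin N) ℝ)
    (u : Fin N → Fin N → ℝ) (lam β : Fin N → ℝ) (hlam : ∀ i, 0 ≤ lam i)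
    (hM : ∀ i j, u i ⬝ᵥ M.mulVec (u j) = if i = j then lam i else 0)
    (k : Fin N) (hk : (k : ℕ) < r) (α : ℝ) :
    ∑ i, ((Matrix.transpose (Matrix.of fun a (i : Fin r) => Real.sqrt (lam (Fin.castLE hrN i)) *
      (β (Fin.castLE hrN i) • M.mulVec (u (Fin.castLE hrN i))) a)).mulVec (α • u k) i) ^ 2 =
      α ^ 2 * β k ^ 2 * lam k ^ 3 := by
  have hcoord (i : Fin r) :
      (Matrix.transpose (Matrix.of fun a (i : Fin r) => Real.sqrt (lam (Fin.castLE hrN i)) *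
        (β (Fin.castLE hrN i) • M.mulVec (u (Fin.castLE hrN i))) a)).mulVec (α • u k) i =
      Real.sqrt (lam (Fin.castLE hrN i)) * β (Fin.castLE hrN i) * α *
        (if k = Fin.castLE hrN i then lam k else 0) := by
    rw [← hM]
    simp only [Matrix.mulVec, dotProduct, Matrix.transpose_apply, Matrix.of_apply,
      Pi.smul_apply, smul_eq_mul,
      Finset.mul_sum (a := Real.sqrt (lam (Fin.castLE hrN i)) * β (Fin.castLE hrN i) * α)]
    exact Finset.sum_congr rfl fun a _ => by ring
  rw [Finset.sum_eq_single (⟨k, hk⟩ : Fin r)]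
  · have hcast : Fin.castLE hrN ⟨k, hk⟩ = k := rfl
    rw [hcoord, hcast, if_pos rfl, mul_pow, mul_pow, mul_pow, Real.sq_sqrt (hlam k)]
    ring
  · intro i _ hi
    have hne : k ≠ Fin.castLE hrN i := fun h => hi (Fin.ext (congrArg Fin.val h).symm)
    rw [hcoord, if_neg hne]
    simp
  · simp

/-- Theorem 4 of the paper in its aligned form: for an edge vector aligned with the
`k`-th generalized eigenvector of both pencils, the combined spectral-embedding energy
`‖V_rᵀ e‖₂² + ‖W_rᵀ e‖₂²` equals `α² β_k² γ³ + α′² β′_k² γ⁻³`, where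
`γ = (eᵀ Q e)/(eᵀ P e) = λ_k`. -/
theorem combined_cubic_inverse_cubic_law {N r : ℕ} (hN : 1 ≤ N) (hr : 1 ≤ r) (hrN : r ≤ N)
    (P Q : Matrix (Fin N) (Fin N) ℝ)
    (u : Fin N → Fin N → ℝ) (lam β : Fin N → ℝ) (hlam : ∀ i, 0 ≤ lam i)
    (hP : ∀ i j, u i ⬝ᵥ P.mulVec (u j) = if i = j then 1 else 0)
    (hQ : ∀ i j, u i ⬝ᵥ Q.mulVec (u j) = if i = j then lam i else 0)
    (u' : Fin N → Fin N → ℝ) (μ β' : Fin N → ℝ) (hμ : ∀ i, 0 ≤ μ i)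
    (hQ' : ∀ i j, u' i ⬝ᵥ Q.mulVec (u' j) = if i = j then 1 else 0)
    (hP' : ∀ i j, u' i ⬝ᵥ P.mulVec (u' j) = if i = j then μ i else 0)
    (k : Fin N) (hk : (k : ℕ) < r) (α α' : ℝ) (hα : α ≠ 0) (hα' : α' ≠ 0)
    (e : Fin N → ℝ) (he : e = α • u k) (he' : e = α' • u' k)
    (hlamk : 0 < lam k) (hμk : μ k = (lam k)⁻¹) :
    let v : Fin N → Fin N → ℝ := fun i => β i • Q.mulVec (u i)
    let V : Matrix (Fin N) (Fin r) ℝ := fun a i =>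
      Real.sqrt (lam (Fin.castLE hrN i)) * v (Fin.castLE hrN i) a
    let w : Fin N → Fin N → ℝ := fun i => β' i • P.mulVec (u' i)
    let W : Matrix (Fin N) (Fin r) ℝ := fun a i =>
      Real.sqrt (μ (Fin.castLE hrN i)) * w (Fin.castLE hrN i) a
    let γ : ℝ := (e ⬝ᵥ Q.mulVec e) / (e ⬝ᵥ P.mulVec e)
    γ = lam k ∧
      (∑ i, (Vᵀ.mulVec e i) ^ 2) + (∑ i, (Wᵀ.mulVec e i) ^ 2) =
        α ^ 2 * (β k) ^ 2 * γ ^ 3 + α' ^ 2 * (β' k) ^ 2 * γ⁻¹ ^ 3 := by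
  intro v V w W γ
  have hγ : γ = lam k := by
    simp only [γ, he, Matrix.mulVec_smul, dotProduct_smul, smul_dotProduct, hP, hQ, if_true,
      smul_eq_mul]
    field_simp
  have hV : ∑ i, (Vᵀ.mulVec e i) ^ 2 = α ^ 2 * β k ^ 2 * lam k ^ 3 := by
    rw [he]
    exact sum_sq_embedding_mulVec_smul hrN Q u lam β hlam hQ k hk α
  have hW : ∑ i, (Wᵀ.mulVec e i) ^ 2 = α' ^ 2 * β' k ^ 2 * μ k ^ 3 := by
    rw [he']
    exact sum_sq_embedding_mulVec_smul hrN P u' μ β' hμ hP' k hk α'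
  exact ⟨hγ, by rw [hV, hW, hγ, hμk]⟩
end
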